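/- Let n >= 2, let α be a cascading n-sequence, and let RC(α) = (ν₁, ..., ν_n), each ν_i identified with its underlying partition. Then for every m in {2, ..., n}: (i) overline(ν_m) ⊆ ν_{m-1}; (ii) ν_{m-1}^t(d) <= overline(ν_m)^t(d) + 2 for every column index d >= 1; (iii) ν_{m-1}^t(d) <= 1 for every d > ν_m(1); and (iv) the number of rows of ν_{m-1}, i.e. ν_{m-1}^t(1), is at most min(n - m + 2, m - 1). -/

import Mathlib

namespace CascRC

abbrev RP := Multiset (ℕ × ℤ)
abbrev RC := ℕ → RP

/-- The Cartan matrix of type `A`. -/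
def cartanA (a b : ℕ) : ℤ :=
  if a = b then 2 else if b = a + 1 ∨ a = b + 1 then -1 else 0

/-- The smallest rigging of a rigged partition (0 if empty). -/
noncomputable def minRig (ν : RP) : ℤ :=
  if h : ν = 0 then 0
  else (ν.map Prod.snd).toFinset.min'
    (Multiset.toFinset_nonempty.mpr (by simpa [Multiset.map_eq_zero] using h))

/-- The greatest length of a string whose rigging is the smallest rigging. -/
noncomputable def selLen (ν : RP) : ℕ :=
  ((ν.filter (fun s => s.2 = minRig ν)).map Prod.fst).sup

/-- The Kashiwara operator `f_a` on rigged configurations. -/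
noncomputable def fOp (a : ℕ) (R : RC) : RC :=
  if R a = 0 ∨ 0 < minRig (R a) then
    fun b => (if b = a then ({(1, -1)} : RP) else 0)
      + (R b).map (fun s => if 0 < s.1 then (s.1, s.2 - cartanA a b) else s)
  else
    fun b =>
      (if b = a then ({(selLen (R a) + 1, minRig (R a) - 1)} : RP) else 0)
      + ((if b = a then (R a).erase (selLen (R a), minRig (R a)) else R b).map
          (fun s => if selLen (R a) < s.1 then (s.1, s.2 - cartanA a b) else s))

/-- A list `γ` acts by `f_γ = f_{γ_p} ∘ ⋯ ∘ f_{γ₁}`. -/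
noncomputable def fList (γ : List ℕ) (R : RC) : RC :=
  γ.foldl (fun S a => fOp a S) R

def emptyRC : RC := fun _ => 0

/-- `RC(α)`: the result of the list `α` acting on the empty rigged configuration. -/
noncomputable def RCseq (α : List ℕ) : RC := fList α emptyRC

/-- The `m`-lower subinterval `(a, a+1, …, m)`. -/
def lowerInt (a m : ℕ) : List ℕ := List.range' a (m + 1 - a)

def IsLowerIv (n : ℕ) (p : ℕ × ℕ) : Prop := 1 ≤ p.1 ∧ p.1 ≤ p.2 ∧ p.2 ≤ n

/-- Ordering between consecutive lower subintervals in a cascading sequence. -/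
def CascCh (p q : ℕ × ℕ) : Prop := q.2 < p.2 ∨ (q.2 = p.2 ∧ p.1 ≤ q.1)

/-- `ivs` is the lower-subinterval decomposition of a cascading `n`-sequence. -/
def IsCascDecomp (n : ℕ) (ivs : List (ℕ × ℕ)) : Prop :=
  (∀ p ∈ ivs, IsLowerIv n p) ∧ ivs.Chain' CascCh

/-- The integer sequence determined by a decomposition into lower subintervals. -/
def seqOf (ivs : List (ℕ × ℕ)) : List ℕ :=
  (ivs.map (fun p => lowerInt p.1 p.2)).flatten

/-- `R_k`: the rigged configuration corresponding to `I_1 ⋯ I_k`. -/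
noncomputable def Rk (ivs : List (ℕ × ℕ)) (k : ℕ) : RC :=
  RCseq (seqOf (ivs.take k))

/-- Height of column `c` of (the underlying partition of) a rigged partition. -/
def colHt (ν : RP) (c : ℕ) : ℕ := (ν.filter (fun s => c ≤ s.1)).card

/-- Length of the `i`-th row (1-based) of the underlying partition. -/
def rowLen (ν : RP) (i : ℕ) : ℕ :=
  ((Finset.Icc 1 ((ν.map Prod.fst).sup)).filter (fun c => i ≤ colHt ν c)).card

/-- Length of the uppermost row of length at most `L` (0 for the virtual empty row). -/
def upRowLen (ν : RP) (L : ℕ) : ℕ := rowLen ν (colHt ν (L + 1) + 1)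

/-- The column to which an application of `f_a` adds a box. -/
noncomputable def selCol (a : ℕ) (R : RC) : ℕ :=
  if R a = 0 ∨ 0 < minRig (R a) then 1 else selLen (R a) + 1

/-- Given a lower subinterval `p = (a, m)` acting on `R`, the column to which the
operator `f_l` occurring in it adds a box in the `l`-th partition. -/
noncomputable def ivCol (p : ℕ × ℕ) (l : ℕ) (R : RC) : ℕ :=
  selCol l (fList (lowerInt p.1 (l - 1)) R)

/-- Lengths `|r_a|, |r_{a+1}|, …` of the rows `r_i` of Lemma "snake":
`rLenSeq R a (i - a) = |r_i|`. -/
def rLenSeq (R : RC) (a : ℕ) : ℕ → ℕ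
  | 0 => rowLen (R a) 1
  | k + 1 => upRowLen (R (a + k + 1)) (rLenSeq R a k)


/-! ### Column heights -/

theorem colHt_antitone (ν : RP) {c d : ℕ} (h : c ≤ d) : colHt ν d ≤ colHt ν c := by
  refine Multiset.card_le_card (Multiset.monotone_filter_right ν ?_)
  intro s hs
  exact h.trans hs

/-- A box can be added to column `c` of `ν`. -/
def Addable (ν : RP) (c : ℕ) : Prop := c = 1 ∨ colHt ν c < colHt ν (c - 1)

theorem le_of_colHt_eq {ν : RP} {c d : ℕ} (hcd : c ≤ d) (h : colHt ν c = colHt ν d)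
    {s : ℕ × ℤ} (hs : s ∈ ν) (hc : c ≤ s.1) : d ≤ s.1 := by
  have hle : ν.filter (fun s => d ≤ s.1) ≤ ν.filter (fun s => c ≤ s.1) :=
    Multiset.monotone_filter_right ν (fun s hs => hcd.trans hs)
  have heq := Multiset.eq_of_le_of_card_le hle h.le
  have : s ∈ ν.filter (fun s => d ≤ s.1) := by
    rw [heq]; exact Multiset.mem_filter.mpr ⟨hs, hc⟩
  exact (Multiset.mem_filter.mp this).2

theorem exists_length_of_addable {ν : RP} {c : ℕ} (h : Addable ν c) (hc : c ≠ 1) :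
    ∃ s ∈ ν, s.1 = c - 1 := by
  rcases h with h | h
  · exact absurd h hc
  by_contra! hne
  refine h.ne (congrArg Multiset.card (Multiset.filter_congr ?_))
  intro s hs
  have := hne s hs
  omega

/-- The rightmost addable column weakly left of `c`. -/
theorem exists_last_addable (ν : RP) {t c : ℕ} (ht : Addable ν t) (h : t ≤ c) :
    ∃ c', t ≤ c' ∧ c' ≤ c ∧ Addable ν c' ∧ colHt ν c' = colHt ν c := by
  induction c, h using Nat.le_induction with
  | base => exact ⟨t, le_rfl, le_rfl, ht, rfl⟩
  | succ c htc ih =>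
    by_cases hadd : Addable ν (c + 1)
    · exact ⟨c + 1, by omega, le_rfl, hadd, rfl⟩
    · obtain ⟨c', h1, h2, h3, h4⟩ := ih
      have hle : colHt ν c ≤ colHt ν (c + 1) := by
        by_contra! hlt
        exact hadd (Or.inr (by simpa using hlt))
      exact ⟨c', h1, by omega, h3, h4.trans (le_antisymm hle (colHt_antitone ν (by omega)))⟩

theorem exists_length_bound (ν : RP) : ∃ N, ∀ s ∈ ν, s.1 < N :=
  ⟨(ν.map Prod.fst).sup + 1, fun _ hs =>
    Nat.lt_succ_of_le (Multiset.le_sup (Multiset.mem_map_of_mem _ hs))⟩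

theorem colHt_eq_zero {ν : RP} {c : ℕ} (h : ∀ s ∈ ν, s.1 < c) : colHt ν c = 0 := by
  simp only [colHt, Multiset.card_eq_zero, Multiset.filter_eq_nil, not_le]
  exact h

theorem colHt_add (ν μ : RP) (d : ℕ) : colHt (ν + μ) d = colHt ν d + colHt μ d := by
  simp [colHt, Multiset.filter_add]

theorem colHt_singleton (s : ℕ × ℤ) (d : ℕ) : colHt {s} d = if d ≤ s.1 then 1 else 0 := by
  unfold colHt
  split_ifs with h <;> simp [Multiset.filter_singleton, h]

theorem colHt_map {f : ℕ × ℤ → ℕ × ℤ} (hf : ∀ s, (f s).1 = s.1) (ν : RP) (d : ℕ) :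
    colHt (ν.map f) d = colHt ν d := by
  simp [colHt, Multiset.filter_map, hf]

theorem colHt_erase {ν : RP} {s : ℕ × ℤ} (hs : s ∈ ν) (d : ℕ) :
    colHt (ν.erase s) d + (if d ≤ s.1 then 1 else 0) = colHt ν d := by
  conv_rhs => rw [← Multiset.cons_erase hs, ← Multiset.singleton_add, colHt_add,
    colHt_singleton]
  omega

/-! ### The Kashiwara operators -/

theorem minRig_mem {ν : RP} (h : ν ≠ 0) : ∃ s ∈ ν, s.2 = minRig ν := by
  have := Finset.min'_mem (ν.map Prod.snd).toFinset
    (Multiset.toFinset_nonempty.mpr (by simpa [Multiset.map_eq_zero] using h))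
  rw [Multiset.mem_toFinset, Multiset.mem_map] at this
  simpa [minRig, h] using this

theorem minRig_le {ν : RP} {s : ℕ × ℤ} (hs : s ∈ ν) : minRig ν ≤ s.2 := by
  have h : ν ≠ 0 := fun h => by simp [h] at hs
  rw [minRig, dif_neg h]
  exact Finset.min'_le _ _ (Multiset.mem_toFinset.mpr (Multiset.mem_map_of_mem _ hs))

theorem selLen_eq {ν : RP} {l : ℕ} {z : ℤ} (hz : minRig ν = z) (hl : (l, z) ∈ ν)
    (h : ∀ s ∈ ν, l < s.1 → z < s.2) : selLen ν = l := by
  refine le_antisymm (Multiset.sup_le.mpr ?_) (Multiset.le_sup ?_)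
  · intro x hx
    obtain ⟨s, hs, rfl⟩ := Multiset.mem_map.mp hx
    obtain ⟨hs, hsz⟩ := Multiset.mem_filter.mp hs
    by_contra! hlt
    have := h s hs hlt
    omega
  · exact Multiset.mem_map.mpr ⟨(l, z), Multiset.mem_filter.mpr ⟨hl, hz.symm⟩, rfl⟩

/-- `f_a` adds its box in column `c`, acting on a string of rigging `z` (the virtual empty
string having rigging `0`). -/
def Selects (ν : RP) (c : ℕ) (z : ℤ) : Prop :=
  (c = 1 ∧ z = 0 ∧ ∀ s ∈ ν, 0 < s.2) ∨
    (2 ≤ c ∧ z ≤ 0 ∧ (c - 1, z) ∈ ν ∧ ∀ s ∈ ν, z ≤ s.2 ∧ (c ≤ s.1 → z < s.2))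

theorem fOp_eq_of_selects {R : RC} {a c : ℕ} {z : ℤ} (h : Selects (R a) c z) (b : ℕ) :
    ∃ ν : RP, ν ≤ R b ∧ (b ≠ a → ν = R b) ∧
      (∀ d, 1 ≤ d → b = a → colHt ν d + (if d ≤ c then 1 else 0) =
        colHt (R b) d + if d = c then 1 else 0) ∧
      fOp a R b = (if b = a then {(c, z - 1)} else 0) +
        ν.map (fun s => if c ≤ s.1 then (s.1, s.2 - cartanA a b) else s) := by
  rcases h with ⟨rfl, rfl, hpos⟩ | ⟨hc, hz, hmem, hmin⟩
  · have hcond : R a = 0 ∨ 0 < minRig (R a) := by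
      by_cases h0 : R a = 0
      · exact Or.inl h0
      · obtain ⟨s, hs, hs'⟩ := minRig_mem h0
        exact Or.inr (hs' ▸ hpos s hs)
    refine ⟨R b, le_rfl, fun _ => rfl, ?_, ?_⟩
    · intro d hd _
      congr 1
      split_ifs <;> omega
    · simp [fOp, hcond, Nat.one_le_iff_ne_zero, Nat.pos_iff_ne_zero]
  · have h0 : R a ≠ 0 := fun h => by simp [h] at hmem
    have hrig : minRig (R a) = z := by
      obtain ⟨s, hs, hs'⟩ := minRig_mem h0
      exact le_antisymm (minRig_le hmem) (hs' ▸ (hmin s hs).1)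
    have hsel : selLen (R a) = c - 1 :=
      selLen_eq hrig hmem fun s hs hlt => (hmin s hs).2 (by omega)
    have hcond : ¬ (R a = 0 ∨ 0 < minRig (R a)) := by
      rw [hrig]; push Not; exact ⟨h0, hz⟩
    refine ⟨if b = a then (R a).erase (c - 1, z) else R b, ?_, ?_, ?_, ?_⟩
    · split_ifs with hb
      · subst hb; exact Multiset.erase_le _ _
      · exact le_rfl
    · intro hb; simp [hb]
    · rintro d hd rfl
      have := colHt_erase hmem d
      simp only [if_true] at this ⊢
      split_ifs at this ⊢ <;> omega
    · have hc1 : c - 1 + 1 = c := by omega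
      have hlt : ∀ x : ℕ, c - 1 < x ↔ c ≤ x := by omega
      rw [fOp, if_neg hcond]
      simp only [hsel, hrig, hc1, hlt]

theorem colHt_fOp_self {R : RC} {a c : ℕ} {z : ℤ} (h : Selects (R a) c z) {d : ℕ}
    (hd : 1 ≤ d) : colHt (fOp a R a) d = colHt (R a) d + if d = c then 1 else 0 := by
  obtain ⟨ν, -, -, hν, heq⟩ := fOp_eq_of_selects h a
  rw [heq, colHt_add, colHt_map (by intro s; split_ifs <;> rfl), ← hν d hd rfl, if_pos rfl,
    colHt_singleton, Nat.add_comm]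

theorem colHt_fOp_of_ne {R : RC} {a b c : ℕ} {z : ℤ} (h : Selects (R a) c z) (hb : b ≠ a)
    (d : ℕ) : colHt (fOp a R b) d = colHt (R b) d := by
  obtain ⟨ν, -, hν, -, heq⟩ := fOp_eq_of_selects h b
  rw [heq, colHt_add, colHt_map (by intro s; split_ifs <;> rfl), hν hb, if_neg hb]
  simp [colHt]

theorem mem_fOp_self {R : RC} {a c : ℕ} {z : ℤ} (h : Selects (R a) c z) {t : ℕ × ℤ}
    (ht : t ∈ fOp a R a) :
    t = (c, z - 1) ∨ ∃ s ∈ R a, t = (s.1, s.2 - if c ≤ s.1 then 2 else 0) := by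
  obtain ⟨ν, hle, -, -, heq⟩ := fOp_eq_of_selects h a
  rw [heq, if_pos rfl, Multiset.mem_add, Multiset.mem_singleton, Multiset.mem_map] at ht
  rcases ht with ht | ⟨s, hs, rfl⟩
  · exact Or.inl ht
  · refine Or.inr ⟨s, Multiset.mem_of_le hle hs, ?_⟩
    split_ifs <;> simp [cartanA]

theorem mem_fOp_of_ne {R : RC} {a b c : ℕ} {z : ℤ} (h : Selects (R a) c z) (hb : b ≠ a)
    {t : ℕ × ℤ} (ht : t ∈ fOp a R b) :
    ∃ s ∈ R b, t = (s.1, s.2 - if c ≤ s.1 then cartanA a b else 0) := by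
  obtain ⟨ν, hle, -, -, heq⟩ := fOp_eq_of_selects h b
  rw [heq, if_neg hb, zero_add, Multiset.mem_map] at ht
  obtain ⟨s, hs, rfl⟩ := ht
  refine ⟨s, Multiset.mem_of_le hle hs, ?_⟩
  split_ifs <;> simp

theorem fOp_eq_zero {R : RC} {a b c : ℕ} {z : ℤ} (h : Selects (R a) c z) (hb : b ≠ a)
    (h0 : R b = 0) : fOp a R b = 0 := by
  refine Multiset.eq_zero_of_forall_notMem fun t ht => ?_
  obtain ⟨s, hs, -⟩ := mem_fOp_of_ne h hb ht
  simp [h0] at hs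

/-! ### Invariants of a cascading sequence -/

/-- The state between two `m`-lower subintervals, the last of which starts at `a`.  The
partitions `R 0, …, R m` interlace; `τ i` is the column of the last box added to `R i` during
the current component, `k` is the number of subintervals of the component applied so far, and
`H` records the column heights of `R m` at the beginning of the component. -/
structure Good (n m a : ℕ) (τ : ℕ → ℕ) (k : ℕ) (H : ℕ → ℕ) (R : RC) : Prop where
  pos : ∀ i, ∀ s ∈ R i, 1 ≤ s.1
  zero : R 0 = 0
  top : R (n + 1) = 0
  le_n : m ≤ n
  close : ∀ i, m < i → ∀ d, 1 ≤ d →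
    colHt (R i) d ≤ colHt (R (i + 1)) d + 1 ∧ colHt (R (i + 1)) d ≤ colHt (R i) d + 1
  rig : ∀ i, i < m → ∀ s ∈ R i, s.2 = 0
  rigTop : ∀ s ∈ R m, -(k : ℤ) ≤ s.2 ∧ (τ m ≤ s.1 → s.2 = -(k : ℤ))
  start : τ m = 0 → k = 0
  lace : ∀ i, i < m → ∀ d, 1 ≤ d →
    colHt (R i) d ≤ colHt (R (i + 1)) d ∧ colHt (R (i + 1)) d ≤ colHt (R i) d + 1
  mono : ∀ i, a ≤ i → i < m → τ (i + 1) ≤ τ i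
  addable : ∀ i, a ≤ i → i ≤ m → Addable (R i) (τ i + 1)
  base : ∀ d, 1 ≤ d → H d ≤ colHt (R (m + 1)) d ∧ colHt (R (m + 1)) d ≤ H d + 1
  strip : ∀ d, 1 ≤ d → H d ≤ colHt (R m) d ∧
    colHt (R m) d ≤ H d + if d ≤ τ m then 1 else 0

/-- The state inside the subinterval `(a, …, m)`, after `f_b` has added a box in column `c`.
For `b = a - 1` no box has been added yet and `c` is any column to the right of everything. -/
structure Mid (n m a b c : ℕ) (τ : ℕ → ℕ) (k : ℕ) (H : ℕ → ℕ) (R : RC) : Prop where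
  pos : ∀ i, ∀ s ∈ R i, 1 ≤ s.1
  zero : R 0 = 0
  top : R (n + 1) = 0
  le_n : m ≤ n
  close : ∀ i, m < i → ∀ d, 1 ≤ d →
    colHt (R i) d ≤ colHt (R (i + 1)) d + 1 ∧ colHt (R (i + 1)) d ≤ colHt (R i) d + 1
  rig : ∀ i, i < m → ∀ s ∈ R i, s.2 =
    (if i = b ∧ c ≤ s.1 then -1 else 0) + (if i = b + 1 ∧ c ≤ s.1 then 1 else 0)
  rigTop : ∀ s ∈ R m,
    -(k : ℤ) + (if m = b + 1 ∧ c ≤ s.1 then 1 else 0) ≤ s.2 ∧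
      (τ m ≤ s.1 → s.2 = -(k : ℤ) + (if m = b + 1 ∧ c ≤ s.1 then 1 else 0))
  start : τ m = 0 → k = 0
  lace : ∀ i, i < m → ∀ d, 1 ≤ d →
    colHt (R i) d ≤ colHt (R (i + 1)) d + (if i = b ∧ d = c then 1 else 0) ∧
      colHt (R (i + 1)) d + (if i = b ∧ d = c then 1 else 0) ≤ colHt (R i) d + 1
  mono : ∀ i, a ≤ i → i < m → i ≠ b → τ (i + 1) ≤ τ i
  addable : ∀ i, a ≤ i → i ≤ m → Addable (R i) (τ i + 1)
  base : ∀ d, 1 ≤ d → H d ≤ colHt (R (m + 1)) d ∧ colHt (R (m + 1)) d ≤ H d + 1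
  strip : ∀ d, 1 ≤ d → H d ≤ colHt (R m) d ∧
    colHt (R m) d ≤ H d + if d ≤ τ m then 1 else 0
  right : τ (b + 1) + 1 ≤ c
  last : a ≤ b → τ b = c

theorem Good.toMid {n m a₀ b : ℕ} {τ : ℕ → ℕ} {k : ℕ} {H : ℕ → ℕ} {R : RC}
    (hG : Good n m a₀ τ k H R) (ha : a₀ ≤ b + 1) (hb : b + 1 ≤ m) :
    ∃ c, Mid n m (b + 1) b c τ k H R := by
  obtain ⟨N, hN⟩ := exists_length_bound (R b)
  obtain ⟨M, hM⟩ := exists_length_bound (R (b + 1))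
  obtain ⟨c, hcN, hcM, hcτ⟩ : ∃ c, N ≤ c ∧ M ≤ c ∧ τ (b + 1) + 1 ≤ c :=
    ⟨N + M + (τ (b + 1) + 1), by omega, by omega, by omega⟩
  have hltb : ∀ s ∈ R b, s.1 < c := fun s hs => (hN s hs).trans_le hcN
  have hltb' : ∀ s ∈ R (b + 1), s.1 < c := fun s hs => (hM s hs).trans_le hcM
  refine ⟨c, hG.pos, hG.zero, hG.top, hG.le_n, hG.close, ?_, ?_, hG.start, ?_, ?_, ?_,
    hG.base, hG.strip, hcτ, by omega⟩
  · intro i hi s hs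
    rw [hG.rig i hi s hs, if_neg, if_neg]
    · rfl
    · rintro ⟨rfl, h⟩
      exact absurd (hltb' s hs) (by omega)
    · rintro ⟨rfl, h⟩
      exact absurd (hltb s hs) (by omega)
  · intro s hs
    rw [if_neg, add_zero]
    · exact hG.rigTop s hs
    · rintro ⟨rfl, h⟩
      exact absurd (hltb' s hs) (by omega)
  · intro i hi d hd
    have := hG.lace i hi d hd
    split_ifs with h
    · obtain ⟨rfl, rfl⟩ := h
      have := colHt_eq_zero hltb
      have := colHt_eq_zero hltb'
      omega
    · omega
  · intro i hi hm _
    exact hG.mono i (by omega) hm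
  · intro i hi hm
    exact hG.addable i (by omega) hm

/-- The column and rigging selected by `f_{b+1}`. -/
theorem Mid.selects {n m a b c : ℕ} {τ : ℕ → ℕ} {k : ℕ} {H : ℕ → ℕ} {R : RC}
    (h : Mid n m a b c τ k H R) (ha : a ≤ b + 1) (hb : b + 1 ≤ m) :
    ∃ c', τ (b + 1) + 1 ≤ c' ∧ c' ≤ c ∧ colHt (R (b + 1)) c' = colHt (R (b + 1)) c ∧
      Selects (R (b + 1)) c' (if b + 1 = m then -(k : ℤ) else 0) ∧
      (∀ s ∈ R (b + 1), c' ≤ s.1 → s.2 = (if b + 1 = m then -(k : ℤ) else 0) + 1) := by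
  obtain ⟨c', h1, h2, h3, h4⟩ :=
    exists_last_addable (R (b + 1)) (h.addable (b + 1) ha hb) h.right
  have hlarge : ∀ s ∈ R (b + 1), c' ≤ s.1 →
      s.2 = (if b + 1 = m then -(k : ℤ) else 0) + 1 := by
    intro s hs hc
    have hc' := le_of_colHt_eq h2 h4 hs hc
    split_ifs with hm
    · subst hm
      rw [(h.rigTop s hs).2 (by omega)]
      simp [hc']
    · rw [h.rig (b + 1) (by omega) s hs]
      simp [hc']
  refine ⟨c', h1, h2, h4, ?_, hlarge⟩
  by_cases hc1 : c' = 1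
  · have hz : (if b + 1 = m then -(k : ℤ) else 0) = 0 := by
      split_ifs with hm
      · subst hm
        have := h.start (by omega)
        omega
      · rfl
    refine Or.inl ⟨hc1, hz, fun s hs => ?_⟩
    rw [hlarge s hs (hc1 ▸ h.pos _ s hs), hz]
    norm_num
  · obtain ⟨s, hs, hsl⟩ := exists_length_of_addable h3 hc1
    have hsmall : s.2 = if b + 1 = m then -(k : ℤ) else 0 := by
      have hlt : ¬ c ≤ s.1 := by omega
      split_ifs with hm
      · subst hm
        rw [(h.rigTop s hs).2 (by omega)]
        simp [hlt]
      · rw [h.rig (b + 1) (by omega) s hs]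
        simp [hlt]
    refine Or.inr ⟨by omega, by split_ifs <;> omega, ?_, ?_⟩
    · rw [← hsl, ← hsmall]
      exact hs
    · intro t ht
      refine ⟨?_, fun hct => by rw [hlarge t ht hct]; omega⟩
      split_ifs with hm
      · subst hm
        have := (h.rigTop t ht).1
        split_ifs at this <;> omega
      · rw [h.rig (b + 1) (by omega) t ht]
        split_ifs <;> omega

/-- Interlacing of the `b`-th and `(b+1)`-st partitions is restored by `f_{b+1}`. -/
theorem Mid.lace_restored {n m a b c c' : ℕ} {τ : ℕ → ℕ} {k : ℕ} {H : ℕ → ℕ} {R : RC}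
    (h : Mid n m a b c τ k H R) (hb : b + 1 ≤ m) (h1 : 1 ≤ c') (h2 : c' ≤ c)
    (h3 : colHt (R (b + 1)) c' = colHt (R (b + 1)) c) {d : ℕ} (hd : 1 ≤ d) :
    colHt (R b) d ≤ colHt (R (b + 1)) d + (if d = c' then 1 else 0) ∧
      colHt (R (b + 1)) d + (if d = c' then 1 else 0) ≤ colHt (R b) d + 1 := by
  have hl := h.lace b (by omega)
  rcases h2.eq_or_lt with rfl | hlt
  · simpa using hl d hd
  have hld := hl d hd
  by_cases hdc : d = c
  · subst hdc
    have hpred := hl (d - 1) (by omega)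
    have e1 := colHt_antitone (R b) (Nat.sub_le d 1)
    have e2 := colHt_antitone (R (b + 1)) (show c' ≤ d - 1 by omega)
    simp only [true_and, if_true, if_neg (show ¬ d - 1 = d by omega),
      if_neg (show ¬ d = c' by omega)] at hld hpred ⊢
    omega
  · by_cases hdc' : d = c'
    · subst hdc'
      have hlc := hl c (by omega)
      have e1 := colHt_antitone (R b) h2
      simp only [true_and, if_true, if_neg hdc] at hld hlc ⊢
      omega
    · simpa [hdc, hdc'] using hld

/-- No string of the `b`-th partition has a length between the columns of the boxes added by
`f_{b+1}` and `f_b`. -/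
theorem Mid.le_length {n m a b c c' : ℕ} {τ : ℕ → ℕ} {k : ℕ} {H : ℕ → ℕ} {R : RC}
    (h : Mid n m a b c τ k H R) (hb : b + 1 ≤ m) (h1 : 1 ≤ c') (h2 : c' ≤ c)
    (h3 : colHt (R (b + 1)) c' = colHt (R (b + 1)) c) {s : ℕ × ℤ} (hs : s ∈ R b)
    (hc : c' ≤ s.1) : c ≤ s.1 := by
  rcases h2.eq_or_lt with rfl | hlt
  · exact hc
  refine le_of_colHt_eq h2 (le_antisymm ?_ (colHt_antitone _ h2)) hs hc
  have e1 := h.lace b (by omega) c' h1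
  have e2 := h.lace b (by omega) c (by omega)
  simp only [true_and, if_true, if_neg hlt.ne] at e1 e2
  omega

theorem cartanA_of_adj {a b : ℕ} (h : b = a + 1 ∨ a = b + 1) : cartanA a b = -1 := by
  rw [cartanA, if_neg (by omega), if_pos h]

theorem cartanA_of_far {a b : ℕ} (h : a ≠ b) (h' : ¬ (b = a + 1 ∨ a = b + 1)) :
    cartanA a b = 0 := by
  rw [cartanA, if_neg h, if_neg h']

theorem colHt_fOp {R : RC} {a c : ℕ} {z : ℤ} (h : Selects (R a) c z) (i : ℕ) {d : ℕ}
    (hd : 1 ≤ d) :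
    colHt (fOp a R i) d = colHt (R i) d + if i = a ∧ d = c then 1 else 0 := by
  by_cases hi : i = a
  · subst hi
    simpa using colHt_fOp_self h hd
  · simpa [hi] using colHt_fOp_of_ne h hi d

theorem pos_fOp {R : RC} {a c : ℕ} {z : ℤ} (h : Selects (R a) c z) (hc : 1 ≤ c)
    (hpos : ∀ i, ∀ s ∈ R i, 1 ≤ s.1) : ∀ i, ∀ s ∈ fOp a R i, 1 ≤ s.1 := by
  intro i t ht
  by_cases hi : i = a
  · subst hi
    rcases mem_fOp_self h ht with rfl | ⟨s, hs, rfl⟩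
    · exact hc
    · exact hpos i s hs
  · obtain ⟨s, hs, rfl⟩ := mem_fOp_of_ne h hi ht
    exact hpos i s hs

theorem addable_fOp_self {R : RC} {a c : ℕ} {z : ℤ} (h : Selects (R a) c z) (hc : 1 ≤ c) :
    Addable (fOp a R a) (c + 1) := by
  refine Or.inr ?_
  rw [Nat.add_sub_cancel, colHt_fOp h a hc, colHt_fOp h a (by omega)]
  have := colHt_antitone (R a) (Nat.le_succ c)
  simp
  omega

theorem addable_fOp_of_ne {R : RC} {a b c e : ℕ} {z : ℤ} (h : Selects (R a) c z) (hb : b ≠ a)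
    (he : Addable (R b) e) : Addable (fOp a R b) e := by
  rwa [Addable, colHt_fOp_of_ne h hb, colHt_fOp_of_ne h hb]

theorem Mid.succ {n m a b c : ℕ} {τ : ℕ → ℕ} {k : ℕ} {H : ℕ → ℕ} {R : RC}
    (h : Mid n m a b c τ k H R) (ha : a ≤ b + 1) (hb : b + 1 < m) :
    ∃ c', Mid n m a (b + 1) c' (Function.update τ (b + 1) c') k H (fOp (b + 1) R) := by
  obtain ⟨c', h1, h2, h3, hsel, hlarge⟩ := h.selects ha hb.le
  simp only [if_neg hb.ne] at hsel hlarge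
  have hc' : 1 ≤ c' := by omega
  have hτ : ∀ i, i ≠ b + 1 → Function.update τ (b + 1) c' i = τ i :=
    fun i hi => Function.update_of_ne hi _ _
  have hτb : Function.update τ (b + 1) c' (b + 1) = c' := Function.update_self _ _ _
  have hne : ∀ i, m ≤ i → ∀ d, colHt (fOp (b + 1) R i) d = colHt (R i) d :=
    fun i hi d => colHt_fOp_of_ne hsel (by omega) d
  refine ⟨c', pos_fOp hsel hc' h.pos, fOp_eq_zero hsel (by omega) h.zero,
    fOp_eq_zero hsel (by have := h.le_n; omega) h.top, h.le_n, ?_, ?_, ?_, ?_, ?_, ?_, ?_, ?_,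
    ?_, ?_, fun _ => hτb⟩
  · intro i hi d hd
    rw [hne i hi.le, hne (i + 1) (by omega)]
    exact h.close i hi d hd
  · intro i hi t ht
    by_cases hib : i = b + 1
    · subst hib
      rcases mem_fOp_self hsel ht with rfl | ⟨s, hs, rfl⟩
      · simp
      · by_cases hcs : c' ≤ s.1
        · simp [hcs, hlarge s hs hcs]
        · have := h.rig (b + 1) hi s hs
          simp [hcs, this, show ¬ c ≤ s.1 by omega]
    · obtain ⟨s, hs, rfl⟩ := mem_fOp_of_ne hsel hib ht
      have hr := h.rig i hi s hs
      by_cases hib0 : i = b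
      · subst hib0
        have := h.le_length hb.le hc' h2 h3 hs
        rw [cartanA_of_adj (Or.inr rfl), hr]
        split_ifs <;> omega
      · by_cases hib2 : i = b + 1 + 1
        · subst hib2
          rw [cartanA_of_adj (Or.inl rfl), hr]
          split_ifs <;> omega
        · rw [cartanA_of_far (by omega) (by omega), hr]
          split_ifs <;> omega
  · intro t ht
    obtain ⟨s, hs, rfl⟩ := mem_fOp_of_ne hsel (by omega) ht
    have hr := h.rigTop s hs
    rw [hτ m (by omega)]
    rw [if_neg (by omega)] at hr
    by_cases hm : m = b + 1 + 1
    · subst hm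
      rw [cartanA_of_adj (Or.inl rfl)]
      simp only [true_and]
      split_ifs <;> constructor <;> intros <;> omega
    · rw [cartanA_of_far (by omega) (by omega)]
      simpa [hm] using hr
  · rw [hτ m (by omega)]
    exact h.start
  · intro i hi d hd
    rw [colHt_fOp hsel i hd, colHt_fOp hsel (i + 1) hd]
    by_cases hib : i = b
    · subst hib
      simpa using h.lace_restored hb.le hc' h2 h3 hd
    · have := h.lace i hi d hd
      simp only [hib, false_and, if_false, Nat.add_right_cancel_iff] at this ⊢
      split_ifs <;> omega
  · intro i hai him hib
    by_cases hib0 : i = b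
    · subst hib0
      rw [hτb, hτ i (by omega), h.last hai]
      exact h2
    · rw [hτ i hib, hτ (i + 1) (by omega)]
      exact h.mono i hai him hib0
  · intro i hai him
    by_cases hib : i = b + 1
    · subst hib
      rw [hτb]
      exact addable_fOp_self hsel hc'
    · rw [hτ i hib]
      exact addable_fOp_of_ne hsel hib (h.addable i hai him)
  · intro d hd
    rw [hne (m + 1) (by omega)]
    exact h.base d hd
  · intro d hd
    rw [hne m le_rfl, hτ m (by omega)]
    exact h.strip d hd
  · rw [hτ (b + 1 + 1) (by omega)]
    have := h.mono (b + 1) ha hb (by omega)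
    omega

theorem Mid.toGood {n a b c : ℕ} {τ : ℕ → ℕ} {k : ℕ} {H : ℕ → ℕ} {R : RC}
    (h : Mid n (b + 1) a b c τ k H R) (ha : a ≤ b + 1) :
    ∃ τ', Good n (b + 1) a τ' (k + 1) H (fOp (b + 1) R) := by
  obtain ⟨c', h1, h2, h3, hsel, hlarge⟩ := h.selects ha le_rfl
  simp only [if_true] at hsel hlarge
  have hc' : 1 ≤ c' := by omega
  have hτ : ∀ i, i ≠ b + 1 → Function.update τ (b + 1) c' i = τ i :=
    fun i hi => Function.update_of_ne hi _ _
  have hτb : Function.update τ (b + 1) c' (b + 1) = c' := Function.update_self _ _ _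
  have hne : ∀ i, b + 1 < i → ∀ d, colHt (fOp (b + 1) R i) d = colHt (R i) d :=
    fun i hi d => colHt_fOp_of_ne hsel (by omega) d
  refine ⟨Function.update τ (b + 1) c', pos_fOp hsel hc' h.pos,
    fOp_eq_zero hsel (by omega) h.zero,
    fOp_eq_zero hsel (by have := h.le_n; omega) h.top, h.le_n, ?_, ?_, ?_, ?_, ?_, ?_, ?_, ?_,
    ?_⟩
  · intro i hi d hd
    rw [hne i hi, hne (i + 1) (by omega)]
    exact h.close i hi d hd
  · intro i hi t ht
    obtain ⟨s, hs, rfl⟩ := mem_fOp_of_ne hsel (by omega) ht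
    have hr := h.rig i hi s hs
    by_cases hib0 : i = b
    · subst hib0
      have := h.le_length le_rfl hc' h2 h3 hs
      rw [cartanA_of_adj (Or.inr rfl), hr]
      split_ifs <;> omega
    · rw [cartanA_of_far (by omega) (by omega), hr]
      split_ifs <;> omega
  · intro t ht
    rw [hτb]
    push_cast
    rcases mem_fOp_self hsel ht with rfl | ⟨s, hs, rfl⟩
    · constructor <;> intros <;> simp; omega
    · by_cases hcs : c' ≤ s.1
      · rw [hlarge s hs hcs, if_pos hcs]
        constructor <;> intros <;> simp <;> omega
      · have := (h.rigTop s hs).1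
        rw [if_neg (by omega)] at this
        simp only [if_neg hcs]
        exact ⟨by omega, fun hc => absurd hc hcs⟩
  · rw [hτb]
    omega
  · intro i hi d hd
    rw [colHt_fOp hsel i hd, colHt_fOp hsel (i + 1) hd]
    by_cases hib : i = b
    · subst hib
      simpa using h.lace_restored le_rfl hc' h2 h3 hd
    · have := h.lace i hi d hd
      simpa [hib, hi.ne] using this
  · intro i hai him
    by_cases hib0 : i = b
    · subst hib0
      rw [hτb, hτ i (by omega), h.last hai]
      exact h2
    · rw [hτ i (by omega), hτ (i + 1) (by omega)]
      exact h.mono i hai him hib0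
  · intro i hai him
    by_cases hib : i = b + 1
    · subst hib
      rw [hτb]
      exact addable_fOp_self hsel hc'
    · rw [hτ i hib]
      exact addable_fOp_of_ne hsel hib (h.addable i hai him)
  · intro d hd
    rw [hne (b + 1 + 1) (by omega)]
    exact h.base d hd
  · intro d hd
    have := h.strip d hd
    rw [colHt_fOp hsel (b + 1) hd, hτb]
    simp only [true_and]
    split_ifs at this ⊢ <;> omega

theorem Mid.fList_range' {n m a : ℕ} {k : ℕ} {H : ℕ → ℕ} (j : ℕ) :
    ∀ {b c : ℕ} {τ : ℕ → ℕ} {R : RC}, Mid n m a b c τ k H R → a ≤ b + 1 → b + 1 + j = m →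
      ∃ τ', Good n m a τ' (k + 1) H (fList (List.range' (b + 1) (j + 1)) R) := by
  induction j with
  | zero =>
    rintro b c τ R h ha rfl
    exact h.toGood ha
  | succ j ih =>
    intro b c τ R h ha hm
    obtain ⟨c', h'⟩ := h.succ ha (by omega)
    exact ih h' (by omega) (by omega)

/-- Applying a further subinterval of the current component. -/
theorem Good.lowerInt {n m a₀ a : ℕ} {τ : ℕ → ℕ} {k : ℕ} {H : ℕ → ℕ} {R : RC}
    (hG : Good n m a₀ τ k H R) (h0 : a₀ ≤ a) (h1 : 1 ≤ a) (ha : a ≤ m) :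
    ∃ τ', Good n m a τ' (k + 1) H (fList (lowerInt a m) R) := by
  obtain ⟨b, rfl⟩ : ∃ b, a = b + 1 := ⟨a - 1, by omega⟩
  obtain ⟨j, rfl⟩ : ∃ j, m = b + 1 + j := ⟨m - (b + 1), by omega⟩
  obtain ⟨c, hM⟩ := hG.toMid h0 ha
  have := hM.fList_range' j le_rfl rfl
  rwa [CascRC.lowerInt, show b + 1 + j + 1 - (b + 1) = j + 1 by omega]

/-- Passing to the next component. -/
theorem Good.pred {n m a : ℕ} {τ : ℕ → ℕ} {k : ℕ} {H : ℕ → ℕ} {R : RC}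
    (hG : Good n (m + 1) a τ k H R) :
    Good n m 1 (fun _ => 0) 0 (colHt (R m)) R where
  pos := hG.pos
  zero := hG.zero
  top := hG.top
  le_n := by have := hG.le_n; omega
  close i hi d hd := by
    rcases (show m + 1 ≤ i from hi).eq_or_lt with rfl | hlt
    · have h1 := hG.base d hd
      have h2 := hG.strip d hd
      split_ifs at h2 <;> omega
    · exact hG.close i hlt d hd
  rig i hi := hG.rig i (by omega)
  rigTop s hs := by simp [hG.rig m (by omega) s hs]
  start _ := rfl
  lace i hi := hG.lace i (by omega)
  mono _ _ _ := le_rfl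
  addable _ _ _ := Or.inl rfl
  base d hd := hG.lace m (by omega) d hd
  strip d hd := ⟨le_rfl, by omega⟩

theorem Good.descend {n m m' a : ℕ} {τ : ℕ → ℕ} {k : ℕ} {H : ℕ → ℕ} {R : RC}
    (hG : Good n m a τ k H R) (h : m' < m) :
    Good n m' 1 (fun _ => 0) 0 (colHt (R m')) R := by
  induction m, (h : m' + 1 ≤ m) using Nat.le_induction generalizing a τ k H with
  | base => exact hG.pred
  | succ m hm ih => exact ih hG.pred

theorem good_empty (n : ℕ) : Good n n 1 (fun _ => 0) 0 (fun _ => 0) emptyRC := by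
  constructor <;> simp [emptyRC, colHt, Addable]

theorem Good.seqOf {n : ℕ} (ivs : List (ℕ × ℕ)) :
    ∀ {m a : ℕ} {τ : ℕ → ℕ} {k : ℕ} {H : ℕ → ℕ} {R : RC}, Good n m a τ k H R →
      (∀ p ∈ ivs, IsLowerIv n p) → ((a, m) :: ivs).IsChain CascCh →
      ∃ m' a' τ' k' H', Good n m' a' τ' k' H' (fList (seqOf ivs) R) := by
  induction ivs with
  | nil => exact fun hG _ _ => ⟨_, _, _, _, _, hG⟩
  | cons p ivs ih =>
    intro m a τ k H R hG hiv hch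
    rw [List.isChain_cons_cons] at hch
    obtain ⟨hp1, hp2, -⟩ := hiv p (by simp)
    have hstep : ∃ τ' k' H', Good n p.2 p.1 τ' k' H' (fList (CascRC.lowerInt p.1 p.2) R) := by
      rcases hch.1 with h | ⟨h, h'⟩
      · obtain ⟨τ', h'⟩ := (hG.descend h).lowerInt hp1 hp1 hp2
        exact ⟨τ', _, _, h'⟩
      · simp only at h h'
        obtain ⟨τ', h'⟩ := hG.lowerInt h' hp1 (h ▸ hp2)
        exact ⟨τ', k + 1, H, h ▸ h'⟩
    obtain ⟨τ', k', H', hG'⟩ := hstep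
    have := ih hG' (fun q hq => hiv q (List.mem_cons_of_mem _ hq)) hch.2
    simpa [CascRC.seqOf, fList] using this

/-- Column heights of adjacent partitions differ by at most one. -/
theorem Good.close_all {n m a : ℕ} {τ : ℕ → ℕ} {k : ℕ} {H : ℕ → ℕ} {R : RC}
    (hG : Good n m a τ k H R) (i : ℕ) {d : ℕ} (hd : 1 ≤ d) :
    colHt (R i) d ≤ colHt (R (i + 1)) d + 1 ∧ colHt (R (i + 1)) d ≤ colHt (R i) d + 1 := by
  rcases lt_trichotomy i m with h | rfl | h
  · have := hG.lace i h d hd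
    omega
  · have h1 := hG.base d hd
    have h2 := hG.strip d hd
    split_ifs at h2 <;> omega
  · exact hG.close i h d hd

theorem exists_good_RCseq {n : ℕ} {ivs : List (ℕ × ℕ)} (hc : IsCascDecomp n ivs) :
    ∃ m a τ k H, Good n m a τ k H (RCseq (seqOf ivs)) := by
  refine (good_empty n).seqOf ivs hc.1 (List.isChain_cons.mpr ⟨?_, hc.2⟩)
  intro p hp
  obtain ⟨h1, -, h3⟩ := hc.1 p (List.mem_of_mem_head? hp)
  exact h3.lt_or_eq.imp id fun h => ⟨h, h1⟩

theorem colHt_eq_zero_of_rowLen_lt {ν : RP} {d : ℕ} (h : rowLen ν 1 < d) :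
    colHt ν d = 0 := by
  by_contra hne
  refine absurd h (not_lt.mpr ?_)
  have hsub : Finset.Icc 1 d ⊆
      (Finset.Icc 1 ((ν.map Prod.fst).sup)).filter (fun c => 1 ≤ colHt ν c) := by
    obtain ⟨s, hs⟩ := Multiset.card_pos_iff_exists_mem.mp (Nat.pos_of_ne_zero hne)
    obtain ⟨hs, hds⟩ := Multiset.mem_filter.mp hs
    have hsup : s.1 ≤ (ν.map Prod.fst).sup := Multiset.le_sup (Multiset.mem_map_of_mem _ hs)
    intro c hc
    rw [Finset.mem_Icc] at hc
    have := colHt_antitone ν hc.2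
    rw [Finset.mem_filter, Finset.mem_Icc]
    omega
  simpa [rowLen] using Finset.card_le_card hsub

/-- Theorem "constraints", first half of the characterization.
Let `n ≥ 2`, `α` a cascading `n`-sequence, `RC(α) = (ν₁, …, ν_n)` (underlying
partitions, described via column heights `colHt` and row lengths `rowLen`).  For
every `2 ≤ m ≤ n`:
(i)   `overline(ν_m) ⊆ ν_{m-1}` (column heights: `colHt (ν m) c - 1 ≤ colHt (ν (m-1)) c`);
(ii)  `ν_{m-1}^t(d) ≤ overline(ν_m)^t(d) + 2` for every `d ≥ 1`;
(iii) `ν_{m-1}^t(d) ≤ 1` for every `d > ν_m(1)`;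
(iv)  the number of rows of `ν_{m-1}` is at most `min (n - m + 2) (m - 1)`. -/
theorem constraints (n : ℕ) (hn : 2 ≤ n)
    (ivs : List (ℕ × ℕ)) (hc : IsCascDecomp n ivs) :
    ∀ m, 2 ≤ m → m ≤ n →
      (∀ c, 1 ≤ c →
        colHt (RCseq (seqOf ivs) m) c - 1 ≤ colHt (RCseq (seqOf ivs) (m - 1)) c) ∧
      (∀ d, 1 ≤ d →
        colHt (RCseq (seqOf ivs) (m - 1)) d ≤ (colHt (RCseq (seqOf ivs) m) d - 1) + 2) ∧
      (∀ d, rowLen (RCseq (seqOf ivs) m) 1 < d →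
        colHt (RCseq (seqOf ivs) (m - 1)) d ≤ 1) ∧
      colHt (RCseq (seqOf ivs) (m - 1)) 1 ≤ min (n - m + 2) (m - 1) := by
  obtain ⟨M, a, τ, k, H, hG⟩ := exists_good_RCseq hc
  intro m hm hmn
  obtain ⟨i, rfl⟩ : ∃ i, m = i + 1 := ⟨m - 1, by omega⟩
  simp only [Nat.add_sub_cancel]
  have hclose := fun j d (hd : 1 ≤ d) => hG.close_all j hd
  have hlow : ∀ j, colHt (RCseq (seqOf ivs) j) 1 ≤ j := by
    intro j
    induction j with
    | zero => simp [hG.zero, colHt]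
    | succ j ih => have := hclose j 1 le_rfl; omega
  have hhigh : ∀ j, j ≤ n + 1 → colHt (RCseq (seqOf ivs) (n + 1 - j)) 1 ≤ j := by
    intro j
    induction j with
    | zero => simp [hG.top, colHt]
    | succ j ih =>
      intro hj
      have h1 := hclose (n + 1 - (j + 1)) 1 le_rfl
      have h2 := ih (by omega)
      rw [show n + 1 - (j + 1) + 1 = n + 1 - j by omega] at h1
      omega
  refine ⟨?_, ?_, ?_, ?_⟩
  · intro c hc
    have := hclose i c hc
    omega
  · intro d hd
    have := hclose i d hd
    omega
  · intro d hd
    have := hclose i d (by omega)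
    have := colHt_eq_zero_of_rowLen_lt hd
    omega
  · refine le_min ?_ (hlow i)
    have := hhigh (n + 1 - i) (by omega)
    rw [show n + 1 - (n + 1 - i) = i by omega] at this
    omega

end CascRC
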